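/- Let G be a finite connected vertex-transitive simple graph on n ≥ 4 vertices, d-regular with adjacency matrix A, let M' = (1/2)·(I + (1/d)·A) be the lazy transition matrix, let λ_2 be the second largest eigenvalue of M', and set τ = 1 − λ_2. Fix a vertex r and an integer k ≥ 1, and set q_k = (M'^k) r r − 1/n. Then (1 + (ln n)/(ln q_k)) · (1 − q_k^{1/k}) ≤ τ ≤ 1 − q_k^{1/k}. -/

import Mathlib

open scoped Classical

/-- The trace of a power of a real symmetric matrix is the corresponding power sum of its
eigenvalues. -/
theorem trace_pow_eq_sum_eigenvalues_pow {V : Type*} [Fintype V] [DecidableEq V]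
    {B : Matrix V V ℝ} (hB : B.IsHermitian) (k : ℕ) :
    (B ^ k).trace = ∑ i, hB.eigenvalues i ^ k := by
  conv_lhs => rw [hB.spectral_theorem]
  rw [← map_pow, Unitary.conjStarAlgAut_apply, Matrix.trace_mul_cycle, Unitary.coe_star_mul_self,
    one_mul, Matrix.diagonal_pow, Matrix.trace_diagonal]
  simp

/-- A real number with a nonzero eigenvector is one of the eigenvalues of a symmetric matrix. -/
theorem exists_eigenvalues_eq {V : Type*} [Fintype V] [DecidableEq V]
    {B : Matrix V V ℝ} (hB : B.IsHermitian) {μ : ℝ} {v : V → ℝ} (hv : v ≠ 0)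
    (h : B.mulVec v = μ • v) : ∃ i, hB.eigenvalues i = μ := by
  have hmem : μ ∈ spectrum ℝ B := by
    rw [← Matrix.spectrum_toLin']
    refine Module.End.HasEigenvalue.mem_spectrum
      (Module.End.hasEigenvalue_of_hasEigenvector (x := v) ⟨?_, hv⟩)
    rw [Module.End.mem_eigenspace_iff, Matrix.toLin'_apply, h]
  rwa [hB.spectrum_real_eq_range_eigenvalues] at hmem

/-- Powers of `a - e`, where `e` is an idempotent absorbed by `a` on both sides. -/
theorem sub_idempotent_pow {R : Type*} [Ring R] {a e : R} (hae : a * e = e) (hea : e * a = e)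
    (hee : e * e = e) (k : ℕ) : (a - e) ^ (k + 1) = a ^ (k + 1) - e := by
  induction k with
  | zero => simp
  | succ k ih =>
    have hpow : a ^ (k + 1) * e = e := by
      clear ih
      induction k with
      | zero => simpa using hae
      | succ k ih => rw [pow_succ, mul_assoc, hae, ih]
    rw [pow_succ, ih, sub_mul, mul_sub, mul_sub, hpow, hea, hee, ← pow_succ]
    simp

/-- The diagonal of a power of a matrix is constant along a symmetry of the matrix. -/
theorem pow_apply_symm {V : Type*} [Fintype V] [DecidableEq V] {M : Matrix V V ℝ} (e : V ≃ V)
    (h : ∀ i j, M (e i) (e j) = M i j) (k : ℕ) (i j : V) : (M ^ k) (e i) (e j) = (M ^ k) i j := by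
  have hM : Matrix.reindexRingEquiv ℝ e.symm M = M := by
    ext i j
    simp [h]
  have hpow := congrFun (congrFun (map_pow (Matrix.reindexRingEquiv ℝ e.symm) M k) i) j
  rw [hM] at hpow
  simpa using hpow

/-- Eigenvalues of the lazy transition matrix of a regular graph lie in the unit interval. -/
theorem lazy_eigenvalue_mem_Icc {V : Type*} [Fintype V] [DecidableEq V] (G : SimpleGraph V)
    [DecidableRel G.Adj] {d : ℕ} (hd : 0 < d) (hreg : G.IsRegularOfDegree d) {μ : ℝ} {v : V → ℝ}
    (hv : v ≠ 0)
    (h : ((1 / 2 : ℝ) • ((1 : Matrix V V ℝ) + (1 / (d : ℝ)) • G.adjMatrix ℝ)).mulVec v = μ • v) :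
    0 ≤ μ ∧ μ ≤ 1 := by
  have hd' : (0 : ℝ) < d := by exact_mod_cast hd
  obtain ⟨y, hy⟩ := Function.ne_iff.mp hv
  obtain ⟨x, -, hx⟩ := Finset.exists_max_image Finset.univ (fun x => |v x|) ⟨y, Finset.mem_univ y⟩
  have hx0 : 0 < |v x| := (abs_pos.mpr hy).trans_le (hx y (Finset.mem_univ y))
  have hAx : ∑ u ∈ G.neighborFinset x, v u = d * (2 * μ - 1) * v x := by
    have := congrFun h x
    simp only [Matrix.smul_mulVec, Matrix.add_mulVec, Matrix.one_mulVec, Pi.smul_apply,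
      Pi.add_apply, SimpleGraph.adjMatrix_mulVec_apply, smul_eq_mul] at this
    field_simp at this
    linarith
  have hle : |∑ u ∈ G.neighborFinset x, v u| ≤ d * |v x| := by
    refine (Finset.abs_sum_le_sum_abs _ _).trans
      ((Finset.sum_le_card_nsmul _ _ _ fun u _ => hx u (Finset.mem_univ u)).trans ?_)
    rw [G.card_neighborFinset_eq_degree, hreg x, nsmul_eq_mul]
  rw [hAx, abs_mul, abs_mul, Nat.abs_cast] at hle
  have h1 : |2 * μ - 1| ≤ 1 := by
    by_contra! hlt
    have := mul_lt_mul_of_pos_left hlt (mul_pos hd' hx0)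
    nlinarith
  rw [abs_le] at h1
  constructor <;> linarith

/-- From `l ^ k ≤ N * q` and `q ≤ l ^ k` to bounds on `1 - l` in terms of `q ^ (1 / k)`. -/
theorem gap_bounds_of_pow_bounds {l q N : ℝ} {k : ℕ} (hk : k ≠ 0) (hN : 1 ≤ N) (hl0 : 0 ≤ l)
    (hl1 : l ≤ 1) (hq0 : 0 ≤ q) (hq : q ≤ l ^ k) (hlq : l ^ k ≤ N * q) :
    (1 + Real.log N / Real.log q) * (1 - q ^ ((1 : ℝ) / k)) ≤ 1 - l ∧
      1 - l ≤ 1 - q ^ ((1 : ℝ) / k) := by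
  have hq1 : q ≤ 1 := hq.trans (pow_le_one₀ hl0 hl1)
  have hk0 : (0 : ℝ) < k := by positivity
  rw [one_div]
  set x := q ^ ((k : ℝ)⁻¹) with hx
  have hxk : x ^ k = q := Real.rpow_inv_natCast_pow hq0 hk
  have hx0 : 0 ≤ x := Real.rpow_nonneg hq0 _
  have hxl : x ≤ l := le_of_pow_le_pow_left₀ hk hl0 (hxk.trans_le hq)
  refine ⟨?_, by linarith⟩
  rcases hq0.eq_or_lt with hzero | hpos
  · have hl : l = 0 := by
      rw [← hzero, mul_zero] at hlq
      exact eq_zero_of_pow_eq_zero (le_antisymm hlq (by positivity))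
    have : x = 0 := by rw [hx, ← hzero, Real.zero_rpow (by positivity)]
    simp [← hzero, hl, this]
  rcases hq1.eq_or_lt with hone | hlt
  · simp [hx, hone, hl1]
  have hlog : Real.log q < 0 := Real.log_neg hpos hlt
  set a := 1 + Real.log N / Real.log q with ha
  have ha1 : a ≤ 1 := by
    have := div_nonpos_of_nonneg_of_nonpos (Real.log_nonneg hN) hlog.le
    linarith
  rcases le_total a 0 with ha0 | ha0
  · nlinarith
  have hxa : (x ^ a) ^ k = N * q := by
    rw [← Real.rpow_natCast, ← Real.rpow_mul hx0, mul_comm a, Real.rpow_mul hx0, Real.rpow_natCast,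
      hxk, Real.rpow_def_of_pos hpos, ha]
    have : Real.log q * (1 + Real.log N / Real.log q) = Real.log N + Real.log q := by
      rw [mul_add, mul_one, mul_div_cancel₀ _ hlog.ne, add_comm]
    rw [this, Real.exp_add, Real.exp_log (by linarith), Real.exp_log hpos]
  have hlx : l ≤ x ^ a :=
    le_of_pow_le_pow_left₀ hk (Real.rpow_nonneg hx0 _) (hlq.trans_eq hxa.symm)
  have hbern := rpow_one_add_le_one_add_mul_self (s := x - 1) (by linarith) ha0 ha1
  rw [add_sub_cancel] at hbern
  linarith

/-- Under the hypotheses of Statement 10, with `τ = 1 - lam2`: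
`(1 + ln n / ln q_k) (1 - q_k^{1/k}) ≤ τ ≤ 1 - q_k^{1/k}`. -/
theorem stmt_11 {V : Type*} [Fintype V] [DecidableEq V] (G : SimpleGraph V)
    (hc : G.Connected)
    (hvt : ∀ u v : V, ∃ φ : G ≃g G, φ u = v)
    (hcard : 4 ≤ Fintype.card V)
    (d : ℕ) (hreg : G.IsRegularOfDegree d)
    (M' : Matrix V V ℝ)
    (hM' : M' = (1 / 2 : ℝ) • ((1 : Matrix V V ℝ) + (1 / (d : ℝ)) • G.adjMatrix ℝ))
    (lam2 : ℝ)
    (hlam2ev : ∃ v : V → ℝ, v ≠ 0 ∧ (∑ x, v x) = 0 ∧ M'.mulVec v = lam2 • v)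
    (hlam2max : ∀ (mu : ℝ) (v : V → ℝ), v ≠ 0 → (∑ x, v x) = 0 →
      M'.mulVec v = mu • v → mu ≤ lam2)
    (tau : ℝ) (htau : tau = 1 - lam2)
    (r : V) (k : ℕ) (hk : 1 ≤ k)
    (qk : ℝ) (hqk : qk = (M' ^ k) r r - 1 / (Fintype.card V : ℝ)) :
    (1 + Real.log (Fintype.card V) / Real.log qk) * (1 - qk ^ ((1 : ℝ) / k)) ≤ tau ∧
      tau ≤ 1 - qk ^ ((1 : ℝ) / k) := by
  have hn0 : (0 : ℝ) < Fintype.card V := by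
    have : 0 < Fintype.card V := by omega
    exact_mod_cast this
  have hn1 : (1 : ℝ) ≤ Fintype.card V := by
    have : 1 ≤ Fintype.card V := by omega
    exact_mod_cast this
  have hd : 0 < d := by
    have : Nontrivial V := Fintype.one_lt_card_iff_nontrivial.mp (by omega)
    have := hc.preconnected.degree_pos_of_nontrivial r
    rwa [hreg r] at this
  have hspec : ∀ {μ : ℝ} {v : V → ℝ}, v ≠ 0 → M'.mulVec v = μ • v → 0 ≤ μ ∧ μ ≤ 1 :=
    fun hv h => lazy_eigenvalue_mem_Icc G hd hreg hv (hM' ▸ h)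
  have hsymm : M'.transpose = M' := by
    simp [hM', Matrix.transpose_smul, Matrix.transpose_add, SimpleGraph.transpose_adjMatrix]
  have hrow : ∀ i, ∑ j, M' i j = 1 := by
    intro i
    have hsum : ∑ j, G.adjMatrix ℝ i j = d := by
      have := G.adjMatrix_mulVec_const_apply_of_regular (a := (1 : ℝ)) hreg (v := i)
      simpa [Matrix.mulVec, dotProduct] using this
    have hd' : (d : ℝ) ≠ 0 := by positivity
    simp only [hM', Matrix.smul_apply, Matrix.add_apply, smul_eq_mul, ← Finset.mul_sum,
      Finset.sum_add_distrib, hsum, Matrix.one_apply]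
    simp
    field_simp
    norm_num
  have hcol : ∀ j, ∑ i, M' i j = 1 := by
    intro j
    rw [← hrow j]
    exact Finset.sum_congr rfl fun i _ => congrFun (congrFun hsymm j) i
  set J : Matrix V V ℝ := Matrix.of fun _ _ => 1 / (Fintype.card V : ℝ) with hJ
  have hMJ : M' * J = J := by
    ext i j
    simp [hJ, Matrix.mul_apply, ← Finset.sum_mul, hrow]
  have hJM : J * M' = J := by
    ext i j
    simp [hJ, Matrix.mul_apply, ← Finset.mul_sum, hcol]
  have hJJ : J * J = J := by
    ext i j
    simp [hJ, Matrix.mul_apply, hn0.ne']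
  have hJv : ∀ v : V → ℝ, (∑ x, v x) = 0 → J.mulVec v = 0 := by
    intro v hv
    ext i
    simp [hJ, Matrix.mulVec, dotProduct, ← Finset.mul_sum, hv]
  have hB : (M' - J).IsHermitian := by
    rw [Matrix.IsHermitian, Matrix.conjTranspose_eq_transpose_of_trivial, Matrix.transpose_sub,
      hsymm]
    rfl
  obtain ⟨v, hv, hv0, hvl⟩ := hlam2ev
  obtain ⟨hl0, hl1⟩ := hspec hv hvl
  obtain ⟨i₀, hi₀⟩ := exists_eigenvalues_eq hB (μ := lam2) hv
    (by rw [Matrix.sub_mulVec, hJv v hv0, sub_zero, hvl])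
  have hev : ∀ i, 0 ≤ hB.eigenvalues i ∧ hB.eigenvalues i ≤ lam2 := by
    intro i
    rcases eq_or_ne (hB.eigenvalues i) 0 with h0 | h0
    · rw [h0]
      exact ⟨le_rfl, hl0⟩
    set w : V → ℝ := ⇑(hB.eigenvectorBasis i) with hw
    have hw0 : w ≠ 0 := by
      intro h
      exact hB.eigenvectorBasis.orthonormal.ne_zero i (by ext x; exact congrFun h x)
    have hBw : (M' - J).mulVec w = hB.eigenvalues i • w := hB.mulVec_eigenvectorBasis i
    have hJw : J.mulVec w = 0 := by
      have : J.mulVec ((M' - J).mulVec w) = 0 := by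
        rw [Matrix.mulVec_mulVec, mul_sub, hJM, hJJ, sub_self, Matrix.zero_mulVec]
      rw [hBw, Matrix.mulVec_smul] at this
      exact (smul_eq_zero.mp this).resolve_left h0
    have hsum : ∑ x, w x = 0 := by
      have := congrFun hJw r
      simpa [hJ, Matrix.mulVec, dotProduct, ← Finset.mul_sum, hn0.ne'] using this
    rw [Matrix.sub_mulVec, hJw, sub_zero] at hBw
    exact ⟨(hspec hw0 hBw).1, hlam2max _ w hw0 hsum hBw⟩
  have hdiag : ∀ s, (M' ^ k) s s = (M' ^ k) r r := by
    intro s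
    obtain ⟨φ, rfl⟩ := hvt r s
    refine pow_apply_symm φ.toEquiv (fun i j => ?_) k r r
    have hadj : G.Adj (φ.toEquiv i) (φ.toEquiv j) ↔ G.Adj i j := φ.map_rel_iff
    simp only [hM', Matrix.smul_apply, Matrix.add_apply, Matrix.one_apply,
      EmbeddingLike.apply_eq_iff_eq, SimpleGraph.adjMatrix_apply, hadj]
  have hq : ∑ i, hB.eigenvalues i ^ k = Fintype.card V * qk := by
    rw [← trace_pow_eq_sum_eigenvalues_pow hB k]
    obtain ⟨m, rfl⟩ := Nat.exists_eq_add_of_le' hk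
    rw [sub_idempotent_pow hMJ hJM hJJ]
    simp only [Matrix.trace, Matrix.diag, Matrix.sub_apply, hdiag, hJ, Matrix.of_apply, hqk]
    simp [mul_sub]
  have hle : qk ≤ lam2 ^ k := by
    have := Finset.sum_le_card_nsmul Finset.univ (fun i => hB.eigenvalues i ^ k) (lam2 ^ k)
      fun i _ => pow_le_pow_left₀ (hev i).1 (hev i).2 k
    rw [hq, nsmul_eq_mul, Finset.card_univ] at this
    exact le_of_mul_le_mul_left this hn0
  have hge : lam2 ^ k ≤ Fintype.card V * qk := by
    rw [← hq, ← hi₀]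
    exact Finset.single_le_sum (f := fun i => hB.eigenvalues i ^ k)
      (fun i _ => pow_nonneg (hev i).1 k) (Finset.mem_univ i₀)
  have hq0 : 0 ≤ qk := nonneg_of_mul_nonneg_right ((pow_nonneg hl0 k).trans hge) hn0
  rw [htau]
  exact gap_bounds_of_pow_bounds (by omega) hn1 hl0 hl1 hq0 hle hge
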